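/- Suppose |c₁/(𝓜·exp(−0.5)) − 1| < |c₁/(𝔐·exp(−0.5)) − 1|. Then ‖exp(Q̄)exp(K̄)ᵀ − exp(Q̄K̄ᵀ) ⊙ exp(Q̃K̃ᵀ)‖_F ≤ (c₁/(𝓜·exp(−0.5))) · ‖exp(Q̄K̄ᵀ)‖_F · ‖U_m − exp(Q̃K̃ᵀ)‖_F + |c₁/(𝔐·exp(−0.5)) − 1| · ‖exp(Q̄K̄ᵀ)‖_F · ‖exp(Q̃K̃ᵀ)‖_F. -/

import Mathlib

open Matrix Finset

/-- Entrywise exponential of a real matrix. -/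
noncomputable def eexp {α β : Type*} (A : Matrix α β ℝ) : Matrix α β ℝ := A.map Real.exp

/-- Frobenius norm of a real matrix. -/
noncomputable def frob {α β : Type*} [Fintype α] [Fintype β] (A : Matrix α β ℝ) : ℝ :=
  Real.sqrt (∑ i, ∑ j, (A i j) ^ 2)

/-- The all-ones square matrix. -/
def allOnes (α : Type*) : Matrix α α ℝ := Matrix.of fun _ _ => 1

/-- 𝔐: the maximum of exp(⟨q̄ᵢ₁, k̄ᵢ₂⟩ + 0.5 − (q̄ᵢ₁ⱼ + k̄ᵢ₂ⱼ)). -/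
noncomputable def bigM {ι : Type*} [Fintype ι] [Nonempty ι] {c₁ : ℕ} [NeZero c₁]
    (Q K : Matrix ι (Fin c₁) ℝ) : ℝ :=
  Finset.univ.sup' Finset.univ_nonempty fun p : ι × ι × Fin c₁ =>
    Real.exp ((∑ j, Q p.1 j * K p.2.1 j) + 0.5 - (Q p.1 p.2.2 + K p.2.1 p.2.2))

/-- 𝓜: the minimum of exp(⟨q̄ᵢ₁, k̄ᵢ₂⟩ + 0.5 − (q̄ᵢ₁ⱼ + k̄ᵢ₂ⱼ)). -/
noncomputable def smallM {ι : Type*} [Fintype ι] [Nonempty ι] {c₁ : ℕ} [NeZero c₁]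
    (Q K : Matrix ι (Fin c₁) ℝ) : ℝ :=
  Finset.univ.inf' Finset.univ_nonempty fun p : ι × ι × Fin c₁ =>
    Real.exp ((∑ j, Q p.1 j * K p.2.1 j) + 0.5 - (Q p.1 p.2.2 + K p.2.1 p.2.2))

/-- Z = I_b ⊗ U_p : the block-diagonal 0/1 mask with b diagonal all-ones p×p blocks. -/
def blockZ (b p : ℕ) : Matrix (Fin b × Fin p) (Fin b × Fin p) ℝ :=
  Matrix.kroneckerMap (· * ·) (1 : Matrix (Fin b) (Fin b) ℝ) (allOnes (Fin p))

lemma sq_le_frob_sq {α β : Type*} [Fintype α] [Fintype β] (A : Matrix α β ℝ) (i : α) (j : β) :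
    A i j ^ 2 ≤ frob A ^ 2 := by
  rw [frob, Real.sq_sqrt (by positivity)]
  calc A i j ^ 2 ≤ ∑ j', A i j' ^ 2 :=
        Finset.single_le_sum (f := fun j' => A i j' ^ 2) (fun _ _ => sq_nonneg _) (mem_univ j)
    _ ≤ ∑ i', ∑ j', A i' j' ^ 2 :=
        Finset.single_le_sum (f := fun i' => ∑ j', A i' j' ^ 2)
          (fun _ _ => Finset.sum_nonneg fun _ _ => sq_nonneg _) (mem_univ i)

lemma frob_nonneg {α β : Type*} [Fintype α] [Fintype β] (A : Matrix α β ℝ) : 0 ≤ frob A :=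
  Real.sqrt_nonneg _

attribute [local instance] Matrix.frobeniusNormedAddCommGroup in
lemma frob_add_le {α β : Type*} [Fintype α] [Fintype β] (A B : Matrix α β ℝ) :
    frob (A + B) ≤ frob A + frob B := by
  have frob_eq_norm (C : Matrix α β ℝ) : frob C = ‖C‖ := by
    simp [frob, Matrix.frobenius_norm_def, Real.sqrt_eq_rpow]
  simpa only [frob_eq_norm] using norm_add_le A B

/-- Submultiplicativity of the Frobenius norm under entrywise products, in domination form. -/
lemma frob_le_of_abs_le {α β : Type*} [Fintype α] [Fintype β] {X A B : Matrix α β ℝ} {c : ℝ}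
    (hc : 0 ≤ c) (h : ∀ i j, |X i j| ≤ c * |A i j| * |B i j|) :
    frob X ≤ c * frob A * frob B := by
  have hA := frob_nonneg A
  have hB := frob_nonneg B
  refine Real.sqrt_le_iff.mpr ⟨by positivity, ?_⟩
  have hB2 : frob B ^ 2 = ∑ i, ∑ j, B i j ^ 2 := by
    rw [frob, Real.sq_sqrt (by positivity)]
  rw [mul_pow, hB2, Finset.mul_sum]
  refine Finset.sum_le_sum fun i _ => ?_
  rw [Finset.mul_sum]
  refine Finset.sum_le_sum fun j _ => ?_
  calc X i j ^ 2 = |X i j| ^ 2 := (sq_abs _).symm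
    _ ≤ (c * |A i j| * |B i j|) ^ 2 := by gcongr; exact h i j
    _ = c ^ 2 * A i j ^ 2 * B i j ^ 2 := by simp only [mul_pow, sq_abs]
    _ ≤ c ^ 2 * frob A ^ 2 * B i j ^ 2 := by gcongr ?_ * ?_ * _; exact sq_le_frob_sq A i j
    _ = (c * frob A) ^ 2 * B i j ^ 2 := by ring

lemma smallM_pos {ι : Type*} [Fintype ι] [Nonempty ι] {c₁ : ℕ} [NeZero c₁]
    (Q K : Matrix ι (Fin c₁) ℝ) : 0 < smallM Q K :=
  (Finset.lt_inf'_iff _).mpr fun _ _ => Real.exp_pos _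

lemma exp_add_eq_div (x y : ℝ) :
    Real.exp y = Real.exp x * (1 / (Real.exp (x + 0.5 - y) * Real.exp (-0.5))) := by
  rw [← Real.exp_add, one_div, ← Real.exp_neg, ← Real.exp_add]
  congr 1
  ring

/-- Each entry of `exp(Q) exp(K)ᵀ` is a multiple of the entry of `exp(QKᵀ)`, with ratio between
`c₁ / (𝔐 e)` and `c₁ / (𝓜 e)`. -/
lemma exists_ratio_eexp_mul {ι : Type*} [Fintype ι] [Nonempty ι] {c₁ : ℕ} [NeZero c₁]
    (Q K : Matrix ι (Fin c₁) ℝ) (i k : ι) :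
    ∃ r : ℝ, (eexp Q * (eexp K)ᵀ) i k = eexp (Q * Kᵀ) i k * r ∧
      (c₁ : ℝ) / (bigM Q K * Real.exp (-0.5)) ≤ r ∧
      r ≤ (c₁ : ℝ) / (smallM Q K * Real.exp (-0.5)) := by
  let f : Fin c₁ → ℝ := fun j => Real.exp ((∑ l, Q i l * K k l) + 0.5 - (Q i j + K k j))
  have hle (j : Fin c₁) : f j ≤ bigM Q K :=
    Finset.le_sup' (fun p : ι × ι × Fin c₁ =>
      Real.exp ((∑ j, Q p.1 j * K p.2.1 j) + 0.5 - (Q p.1 p.2.2 + K p.2.1 p.2.2)))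
      (mem_univ (i, k, j))
  have hge (j : Fin c₁) : smallM Q K ≤ f j :=
    Finset.inf'_le (fun p : ι × ι × Fin c₁ =>
      Real.exp ((∑ j, Q p.1 j * K p.2.1 j) + 0.5 - (Q p.1 p.2.2 + K p.2.1 p.2.2)))
      (mem_univ (i, k, j))
  have hconst (x : ℝ) : (c₁ : ℝ) / x = ∑ _j : Fin c₁, 1 / x := by
    simp [div_eq_mul_inv]
  have hs := smallM_pos Q K
  refine ⟨∑ j, 1 / (f j * Real.exp (-0.5)), ?_, ?_, ?_⟩
  · simp only [eexp, Matrix.mul_apply, Matrix.map_apply, Matrix.transpose_apply, Finset.mul_sum]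
    refine Finset.sum_congr rfl fun j _ => ?_
    rw [← Real.exp_add]
    exact exp_add_eq_div _ _
  · rw [hconst]
    refine Finset.sum_le_sum fun j _ => one_div_le_one_div_of_le ?_ ?_
    · exact mul_pos (Real.exp_pos _) (Real.exp_pos _)
    · exact mul_le_mul_of_nonneg_right (hle j) (Real.exp_pos _).le
  · rw [hconst]
    refine Finset.sum_le_sum fun j _ => one_div_le_one_div_of_le (by positivity) ?_
    exact mul_le_mul_of_nonneg_right (hge j) (Real.exp_pos _).le

/-- if |c₁/(𝓜e) − 1| < |c₁/(𝔐e) − 1| (with e = exp(−0.5)), then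
‖exp(Q̄)exp(K̄)ᵀ − exp(Q̄K̄ᵀ) ⊙ exp(Q̃K̃ᵀ)‖_F ≤
  (c₁/(𝓜e)) ‖exp(Q̄K̄ᵀ)‖_F ‖U_m − exp(Q̃K̃ᵀ)‖_F
  + |c₁/(𝔐e) − 1| ‖exp(Q̄K̄ᵀ)‖_F ‖exp(Q̃K̃ᵀ)‖_F. -/
theorem stmt_8 (m c₁ c₂ : ℕ) [NeZero m] [NeZero c₁] [NeZero c₂]
    (Qb Kb : Matrix (Fin m) (Fin c₁) ℝ) (Qt Kt : Matrix (Fin m) (Fin c₂) ℝ)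
    (h : |(c₁ : ℝ) / (smallM Qb Kb * Real.exp (-0.5)) - 1| <
        |(c₁ : ℝ) / (bigM Qb Kb * Real.exp (-0.5)) - 1|) :
    frob (eexp Qb * (eexp Kb)ᵀ - (eexp (Qb * Kbᵀ)).hadamard (eexp (Qt * Ktᵀ))) ≤
      (c₁ : ℝ) / (smallM Qb Kb * Real.exp (-0.5)) * frob (eexp (Qb * Kbᵀ)) *
          frob (allOnes (Fin m) - eexp (Qt * Ktᵀ)) +
        |(c₁ : ℝ) / (bigM Qb Kb * Real.exp (-0.5)) - 1| * frob (eexp (Qb * Kbᵀ)) *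
          frob (eexp (Qt * Ktᵀ)) := by
  choose r hr hlo hhi using exists_ratio_eexp_mul Qb Kb
  have hs := smallM_pos Qb Kb
  set a := (c₁ : ℝ) / (bigM Qb Kb * Real.exp (-0.5))
  set b := (c₁ : ℝ) / (smallM Qb Kb * Real.exp (-0.5))
  set S := eexp (Qb * Kbᵀ)
  set T := eexp (Qt * Ktᵀ)
  have hb0 : 0 ≤ b := by positivity
  have hr0 (i k) : 0 ≤ r i k := by
    have hSpos : 0 < S i k := Real.exp_pos _
    refine (mul_nonneg_iff_of_pos_left hSpos).mp ?_
    rw [← hr, Matrix.mul_apply]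
    exact Finset.sum_nonneg fun j _ => mul_nonneg (Real.exp_pos _).le (Real.exp_pos _).le
  have hsplit : eexp Qb * (eexp Kb)ᵀ - S.hadamard T =
      Matrix.of (fun i k => r i k * S i k * (1 - T i k)) +
        Matrix.of (fun i k => (r i k - 1) * S i k * T i k) := by
    ext i k
    simp only [Matrix.sub_apply, Matrix.add_apply, Matrix.of_apply, Matrix.hadamard_apply, hr]
    ring
  rw [hsplit]
  refine (frob_add_le _ _).trans (add_le_add ?_ ?_)
  · refine frob_le_of_abs_le hb0 fun i k => ?_
    simp only [Matrix.of_apply, abs_mul, abs_of_nonneg (hr0 i k), Matrix.sub_apply, allOnes]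
    gcongr
    exact hhi i k
  · refine frob_le_of_abs_le (abs_nonneg _) fun i k => ?_
    simp only [Matrix.of_apply, abs_mul]
    gcongr ?_ * _ * _
    calc |r i k - 1| ≤ max |a - 1| |b - 1| :=
          abs_le_max_abs_abs (sub_le_sub_right (hlo i k) 1) (sub_le_sub_right (hhi i k) 1)
      _ = |a - 1| := max_eq_left h.le
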